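/- arXiv:2202.08653 — 3 statements merged into one kernel-verified Lean document; each statement's English description precedes it below -/
import Mathlib

section
/- Let Φ : C_κ → F_κ be convex and monotone with Φ(0) = 0, where F_κ is the set of all functions f : X → [-∞,∞) with ‖f⁺‖_κ < ∞. Then: (i) for every r > 0 and f ∈ B_{C_κ}(r), the function Φf is real-valued and ‖Φf‖_κ ≤ c‖f‖_κ with c := (1/r)·‖(Φ(r/κ))⁺‖_κ < ∞; (ii) for every r > 0 and f, g ∈ B_{C_κ}(r), ‖Φf − Φg‖_κ ≤ c'‖f − g‖_κ with c' := (1/r)·sup_{f' ∈ B_{C_κ}(3r)} ‖Φf'‖_κ < ∞. -/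
open Filter MeasureTheory Topology
open scoped ENNReal Topology

noncomputable section

def ecoe {X : Type*} (f : X → ℝ) : X → EReal := fun x => (f x : EReal)

variable {X : Type*} [MetricSpace X]

/-- membership in `C_κ` -/
def MemCk (κ : X → ℝ) (f : X → ℝ) : Prop :=
  Continuous f ∧ ∃ r : ℝ, ∀ x, |f x| * κ x ≤ r

/-- `‖f‖_κ ≤ r` -/
def CkBound (κ : X → ℝ) (r : ℝ) (f : X → ℝ) : Prop := ∀ x, |f x| * κ x ≤ r

/-- extended `κ`-norm of an `EReal`-valued function -/
def eknorm (κ : X → ℝ) (f : X → EReal) : ℝ≥0∞ :=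
  ⨆ x, (f x).abs * ENNReal.ofReal (κ x)

/-- positive part of an `EReal`-valued function -/
def epos {X : Type*} (f : X → EReal) : X → EReal := fun x => max (f x) 0

/-- membership in `U_κ` -/
def MemUk (κ : X → ℝ) (f : X → EReal) : Prop :=
  UpperSemicontinuous f ∧ (∀ x, f x < ⊤) ∧
    ∃ r : ℝ, ∀ x, max (f x) 0 * (κ x : EReal) ≤ (r : EReal)

/-- `Γ`-limsup of a sequence of functions -/
def gammaLimsup (f : ℕ → X → EReal) (x : X) : EReal :=
  ⨆ (u : ℕ → X) (_ : Tendsto u atTop (𝓝 x)),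
    Filter.limsup (fun n => f n (u n)) atTop

/-- `g = Γ-lim f_n` -/
def IsGammaLim (f : ℕ → X → EReal) (g : X → EReal) : Prop :=
  ∀ x : X,
    (∀ u : ℕ → X, Tendsto u atTop (𝓝 x) →
      Filter.limsup (fun n => f n (u n)) atTop ≤ g x) ∧
    (∃ u : ℕ → X, Tendsto u atTop (𝓝 x) ∧
      Tendsto (fun n => f n (u n)) atTop (𝓝 (g x)))

/-- `Γ`-limsup as `h ↓ 0` -/
def gammaLimsupZero (F : ℝ → X → EReal) (x : X) : EReal :=
  ⨆ (h : ℕ → ℝ) (_ : ∀ n, 0 < h n) (_ : Tendsto h atTop (𝓝 (0:ℝ))),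
    gammaLimsup (fun n => F (h n)) x

/-- `Γ`-limsup as `s → t`, `s ≥ 0` -/
def gammaLimsupAt (F : ℝ → X → EReal) (t : ℝ) (x : X) : EReal :=
  ⨆ (s : ℕ → ℝ) (_ : ∀ n, 0 ≤ s n) (_ : Tendsto s atTop (𝓝 t)),
    gammaLimsup (fun n => F (s n)) x

/-- Assumption S on a family of operators on `U_κ` -/
structure AssumptionS (κ : X → ℝ) (S : ℝ → (X → EReal) → (X → EReal)) : Prop where
  monotone : ∀ t, 0 ≤ t → ∀ f g, MemUk κ f → MemUk κ g →
    (∀ x, f x ≤ g x) → ∀ x, S t f x ≤ S t g x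
  convex : ∀ t, 0 ≤ t → ∀ f g, MemUk κ f → MemUk κ g → ∀ lam : ℝ, 0 ≤ lam → lam ≤ 1 →
    ∀ x, S t (fun y => (lam : EReal) * f y + ((1 - lam : ℝ) : EReal) * g y) x
      ≤ (lam : EReal) * S t f x + ((1 - lam : ℝ) : EReal) * S t g x
  zero : ∀ t, 0 ≤ t → ∀ x, S t (fun _ => (0 : EReal)) x = 0
  maps : ∀ t, 0 ≤ t → ∀ f, MemUk κ f → MemUk κ (S t f)
  contAbove : ∀ t, 0 ≤ t → ∀ (f : ℕ → X → EReal) (g : X → EReal),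
    (∀ n, MemUk κ (f n)) → MemUk κ g →
    (∀ x, Antitone fun n => f n x) → (∀ x, (⨅ n, f n x) = g x) →
    ∀ x, (⨅ n, S t (f n) x) = S t g x
  gammaUsc : ∀ t, 0 ≤ t → ∀ f, MemUk κ f →
    ∀ x, gammaLimsupAt (fun s => S s f) t x ≤ S t f x
  idZero : ∀ f, MemUk κ f → S 0 f = f
  bounded : ∀ r t : ℝ, 0 ≤ r → 0 ≤ t → ∃ C : ℝ≥0∞, C ≠ ⊤ ∧
    ∀ s, 0 ≤ s → s ≤ t → ∀ f : X → ℝ, MemCk κ f → CkBound κ r f →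
      eknorm κ (S s (ecoe f)) ≤ C

/-- an `EReal`-valued function which belongs to `C_κ` -/
def IsCk (κ : X → ℝ) (F : X → EReal) : Prop :=
  ∃ g : X → ℝ, MemCk κ g ∧ ∀ x, F x = (g x : EReal)

/-- the upper Lipschitz set `L^S_+` -/
def UpperLip (κ : X → ℝ) (S : ℝ → (X → EReal) → (X → EReal)) (f : X → ℝ) : Prop :=
  MemCk κ f ∧
  (∀ t, 0 ≤ t → IsCk κ (S t (ecoe f))) ∧
  (∀ s t, 0 ≤ s → 0 ≤ t → S (s + t) (ecoe f) = S s (S t (ecoe f))) ∧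
  ∃ h₀ > (0:ℝ), ∃ c ≥ (0:ℝ), ∀ h, 0 ≤ h → h ≤ h₀ → ∀ x,
    max (S h (ecoe f) x - (f x : EReal)) 0 * (κ x : EReal) ≤ ((c * h : ℝ) : EReal)

/-- the (two-sided) Lipschitz set `L^S` -/
def LipSet (κ : X → ℝ) (S : ℝ → (X → EReal) → (X → EReal)) (f : X → ℝ) : Prop :=
  MemCk κ f ∧
  (∀ t, 0 ≤ t → IsCk κ (S t (ecoe f))) ∧
  (∀ s t, 0 ≤ s → 0 ≤ t → S (s + t) (ecoe f) = S s (S t (ecoe f))) ∧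
  ∃ h₀ > (0:ℝ), ∃ c ≥ (0:ℝ), ∀ h, 0 ≤ h → h ≤ h₀ → ∀ x,
    (S h (ecoe f) x - (f x : EReal)).abs * ENNReal.ofReal (κ x) ≤ ENNReal.ofReal (c * h)

/-- difference quotient `(S(h)f - f)/h` -/
def diffQuot (S : ℝ → (X → EReal) → (X → EReal)) (f : X → ℝ) (h : ℝ) : X → EReal :=
  fun x => ((h⁻¹ : ℝ) : EReal) * (S h (ecoe f) x - (f x : EReal))

/-- the upper `Γ`-generator `A_Γ⁺` -/
def uppGen (S : ℝ → (X → EReal) → (X → EReal)) (f : X → ℝ) : X → EReal :=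
  fun x => gammaLimsupZero (fun h => diffQuot S f h) x

/-- `g = A_Γ f`, i.e. the `Γ`-limit of the difference quotients exists and equals `g` -/
def IsGammaDeriv (S : ℝ → (X → EReal) → (X → EReal)) (f : X → ℝ) (g : X → EReal) : Prop :=
  ∀ h : ℕ → ℝ, (∀ n, 0 < h n) → Tendsto h atTop (𝓝 (0:ℝ)) →
    IsGammaLim (fun n => diffQuot S f (h n)) g

/-- `g = Af` in the mixed topology -/
def MixedDeriv (κ : X → ℝ) (S : ℝ → (X → EReal) → (X → EReal)) (f : X → ℝ) (g : X → ℝ) : Prop :=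
  (∃ h₀ > (0:ℝ), ∃ r : ℝ, ∀ h, 0 < h → h ≤ h₀ → ∀ x,
      |h⁻¹ * ((S h (ecoe f) x).toReal - f x)| * κ x ≤ r) ∧
  ∀ K : Set X, IsCompact K → ∀ ε > (0:ℝ), ∃ h₀ > (0:ℝ), ∀ h, 0 < h → h ≤ h₀ → ∀ x ∈ K,
    |h⁻¹ * ((S h (ecoe f) x).toReal - f x) - g x| ≤ ε

/-- upper `ε`-parallel function -/
def parallel (κ : X → ℝ) (f : X → EReal) (ε : ℝ) : X → EReal :=
  fun x => (((κ x)⁻¹ : ℝ) : EReal) *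
    ((⨆ y ∈ Metric.closedBall x ε, max (f y * (κ y : EReal)) (((-ε⁻¹ : ℝ)) : EReal)) + (ε : EReal))

/-- upper semicontinuous envelope of the upper `ε`-parallel function -/
def parallelEnv (κ : X → ℝ) (f : X → EReal) (ε : ℝ) : X → EReal :=
  fun x => ⨅ (δ : ℝ) (_ : 0 < δ), ⨆ y ∈ Metric.closedBall x δ, parallel κ f ε y

end

noncomputable section

/-- truncation of an extended real to `ℝ≥0∞` -/
def erealToENNReal (x : EReal) : ℝ≥0∞ := if x = ⊤ then ⊤ else ENNReal.ofReal x.toReal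

/-- Lebesgue integral of an `EReal`-valued function on `(a,b]`, with values in `[-∞,∞]` -/
def eIntegral (a b : ℝ) (F : ℝ → EReal) : EReal :=
  ((∫⁻ s in Set.Ioc a b, erealToENNReal (max (F s) 0)) : ℝ≥0∞) -
  ((∫⁻ s in Set.Ioc a b, erealToENNReal (max (-F s) 0)) : ℝ≥0∞)

/-- convolution `f * μ` of an `EReal`-valued function with a measure -/
def econv {X : Type*} [NormedAddCommGroup X] [MeasurableSpace X]
    (μ : Measure X) (f : X → EReal) (x : X) : EReal :=
  ((∫⁻ y, erealToENNReal (max (f (x - y)) 0) ∂μ : ℝ≥0∞) : EReal) -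
  ((∫⁻ y, erealToENNReal (max (-f (x - y)) 0) ∂μ : ℝ≥0∞) : EReal)

/-- conjugate functional `φ*` -/
def dualConj {X : Type*} [MetricSpace X] [MeasurableSpace X]
    (κ : X → ℝ) (φ : (X → ℝ) → ℝ) (μ : Measure X) : EReal :=
  ⨆ f : {g : X → ℝ // MemCk κ g}, (((∫ x, f.1 x ∂μ) : ℝ) : EReal) - ((φ f.1 : ℝ) : EReal)

/-- the topology `σ(ca_κ⁺, C_κ)` on measures -/
def weakTopo {X : Type*} [MetricSpace X] [MeasurableSpace X] (κ : X → ℝ) :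
    TopologicalSpace (Measure X) :=
  TopologicalSpace.induced
    (fun μ => fun f : {g : X → ℝ // MemCk κ g} => ∫ x, f.1 x ∂μ) Pi.topologicalSpace

/-- `φ₁`, the extension of `φ` from `C_κ` to `U_κ` -/
def extUk {X : Type*} [MetricSpace X] (κ : X → ℝ) (φ : (X → ℝ) → ℝ) (f : X → EReal) : EReal :=
  ⨅ g : {g : X → ℝ // MemCk κ g ∧ ∀ x, f x ≤ (g x : EReal)}, ((φ g.1 : ℝ) : EReal)

end

theorem memCk_comb {X : Type*} [MetricSpace X] {κ : X → ℝ} (hκpos : ∀ x, 0 < κ x)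
    {f g : X → ℝ} (hf : MemCk κ f) (hg : MemCk κ g) (a b : ℝ) :
    MemCk κ (fun x => a * f x + b * g x) := by
  obtain ⟨hfc, p, hp⟩ := hf
  obtain ⟨hgc, q, hq⟩ := hg
  refine ⟨by fun_prop, |a| * p + |b| * q, fun x => ?_⟩
  have h1 := mul_le_mul_of_nonneg_left (hp x) (abs_nonneg a)
  have h2 := mul_le_mul_of_nonneg_left (hq x) (abs_nonneg b)
  have h3 : |a * f x + b * g x| ≤ |a| * |f x| + |b| * |g x| := by
    rw [← abs_mul, ← abs_mul]; exact abs_add_le _ _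
  have h4 := mul_le_mul_of_nonneg_right h3 (hκpos x).le
  nlinarith

theorem memCk_div {X : Type*} [MetricSpace X] {κ : X → ℝ} (hκc : Continuous κ)
    (hκpos : ∀ x, 0 < κ x) (r : ℝ) : MemCk κ (fun x => r / κ x) := by
  refine ⟨continuous_const.div hκc fun x => (hκpos x).ne', |r|, fun x => ?_⟩
  rw [abs_div, abs_of_pos (hκpos x), div_mul_cancel₀ _ (hκpos x).ne']

theorem term_eq {X : Type*} {κ : X → ℝ} (a : ℝ) (x : X) :
    (a : EReal).abs * ENNReal.ofReal (κ x) = ENNReal.ofReal (|a| * κ x) := by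
  rw [EReal.abs_def, ENNReal.ofReal_mul (abs_nonneg a)]

theorem eknorm_le_iff {X : Type*} [MetricSpace X] {κ : X → ℝ}
    {F : X → EReal} {f : X → ℝ} (hF : ∀ x, F x = (f x : EReal)) {c : ℝ} (hc : 0 ≤ c) :
    eknorm κ F ≤ ENNReal.ofReal c ↔ CkBound κ c f := by
  unfold eknorm CkBound
  simp only [iSup_le_iff, hF, term_eq, ENNReal.ofReal_le_ofReal_iff hc]

theorem eknorm_real {X : Type*} [MetricSpace X] {κ : X → ℝ}
    {F : X → EReal} {f : X → ℝ} (hF : ∀ x, F x = (f x : EReal)) (h : eknorm κ F ≠ ⊤) :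
    ∃ n : ℝ, 0 ≤ n ∧ eknorm κ F = ENNReal.ofReal n ∧ CkBound κ n f ∧
      ∀ r, 0 ≤ r → CkBound κ r f → n ≤ r := by
  refine ⟨(eknorm κ F).toReal, ENNReal.toReal_nonneg, (ENNReal.ofReal_toReal h).symm, ?_, ?_⟩
  · rw [← eknorm_le_iff hF ENNReal.toReal_nonneg, ENNReal.ofReal_toReal h]
  · intro r hr hb
    exact ENNReal.toReal_le_of_le_ofReal hr ((eknorm_le_iff hF hr).2 hb)

theorem eknorm_ecoe_ne_top {X : Type*} [MetricSpace X] {κ : X → ℝ}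
    {f : X → ℝ} (hf : MemCk κ f) : eknorm κ (ecoe f) ≠ ⊤ := by
  obtain ⟨_, p, hp⟩ := hf
  have : CkBound κ (max p 0) f := fun x => (hp x).trans (le_max_left _ _)
  exact ne_top_of_le_ne_top ENNReal.ofReal_ne_top
    ((eknorm_le_iff (fun _ => rfl) (le_max_right _ _)).2 this)

theorem phi_real {X : Type*} [MetricSpace X] {κ : X → ℝ} (hκpos : ∀ x, 0 < κ x)
    (Φ : (X → ℝ) → (X → EReal))
    (hconv : ∀ f g, MemCk κ f → MemCk κ g → ∀ lam : ℝ, 0 ≤ lam → lam ≤ 1 → ∀ x,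
        Φ (fun y => lam * f y + (1 - lam) * g y) x
          ≤ (lam : EReal) * Φ f x + ((1 - lam : ℝ) : EReal) * Φ g x)
    (hzero : ∀ x, Φ (fun _ => 0) x = 0)
    (hFk : ∀ f, MemCk κ f → (∀ x, Φ f x < ⊤) ∧ eknorm κ (epos (Φ f)) ≠ ⊤)
    (f : X → ℝ) (hf : MemCk κ f) (x : X) : Φ f x = ((Φ f x).toReal : EReal) := by
  refine (EReal.coe_toReal ((hFk f hf).1 x).ne ?_).symm
  intro hbot
  have hg : MemCk κ (fun y => (-1) * f y + 0 * f y) := memCk_comb hκpos hf hf _ _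
  have h := hconv f _ hf hg (1/2) (by norm_num) (by norm_num) x
  have e : (fun y => (1/2 : ℝ) * f y + (1 - 1/2) * ((-1) * f y + 0 * f y)) = fun _ => 0 := by
    funext y; ring
  rw [e, hzero, hbot, EReal.coe_mul_bot_of_pos (by norm_num), EReal.bot_add] at h
  simp at h

theorem key1 {X : Type*} [MetricSpace X] {κ : X → ℝ} (hκc : Continuous κ)
    (hκpos : ∀ x, 0 < κ x) (φ : (X → ℝ) → X → ℝ)
    (hmono : ∀ f g, MemCk κ f → MemCk κ g → (∀ x, f x ≤ g x) → ∀ x, φ f x ≤ φ g x)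
    (hconv : ∀ f g, MemCk κ f → MemCk κ g → ∀ lam : ℝ, 0 ≤ lam → lam ≤ 1 → ∀ x,
        φ (fun y => lam * f y + (1 - lam) * g y) x ≤ lam * φ f x + (1 - lam) * φ g x)
    (hzero : ∀ x, φ (fun _ => 0) x = 0)
    {r n : ℝ} (hr : 0 < r) (hn : 0 ≤ n) (hnr : n ≤ r) {f : X → ℝ} (hf : MemCk κ f)
    (hb : CkBound κ n f) (x : X) : |φ f x| ≤ n / r * φ (fun x => r / κ x) x := by
  have h0 : MemCk κ (fun _ : X => (0:ℝ)) := ⟨continuous_const, 0, by simp⟩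
  have hk := memCk_div hκc hκpos r
  have up : ∀ f, MemCk κ f → CkBound κ n f → φ f x ≤ n / r * φ (fun x => r / κ x) x := by
    intro f hf hb
    have h1 := hconv _ _ hk h0 (n / r) (by positivity) ((div_le_one hr).2 hnr) x
    have h2 : (1 - n / r) * φ (fun _ => 0) x = 0 := by rw [hzero, mul_zero]
    rw [h2, add_zero] at h1
    refine (hmono _ _ hf (memCk_comb hκpos hk h0 _ _) (fun y => ?_) x).trans h1
    have e : n / r * (r / κ y) + (1 - n / r) * 0 = n / κ y := by
      have := (hκpos y).ne'
      field_simp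
      ring
    rw [e, le_div_iff₀ (hκpos y)]
    exact (mul_le_mul_of_nonneg_right (le_abs_self _) (hκpos y).le).trans (hb y)
  have hg : MemCk κ (fun y => (-1) * f y + 0 * f y) := memCk_comb hκpos hf hf _ _
  have hgb : CkBound κ n (fun y => (-1) * f y + 0 * f y) := fun y => by
    have := hb y
    simpa using this
  have h := hconv f _ hf hg (1/2) (by norm_num) (by norm_num) x
  have e : (fun y => (1/2 : ℝ) * f y + (1 - 1/2) * ((-1) * f y + 0 * f y)) = fun _ => 0 := by
    funext y; ring
  rw [e, hzero] at h
  have h1 := up f hf hb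
  have h2 := up _ hg hgb
  rw [abs_le]
  constructor <;> linarith

theorem key2 {X : Type*} [MetricSpace X] {κ : X → ℝ}
    (hκpos : ∀ x, 0 < κ x) (φ : (X → ℝ) → X → ℝ)
    (hconv : ∀ f g, MemCk κ f → MemCk κ g → ∀ lam : ℝ, 0 ≤ lam → lam ≤ 1 → ∀ x,
        φ (fun y => lam * f y + (1 - lam) * g y) x ≤ lam * φ f x + (1 - lam) * φ g x)
    {r n C : ℝ} (hr : 0 < r) (hn : 0 ≤ n) (hC : 0 ≤ C)
    (hφ : ∀ f, MemCk κ f → CkBound κ (3 * r) f → CkBound κ C (φ f))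
    {f g : X → ℝ} (hf : MemCk κ f) (hg : MemCk κ g) (hfb : CkBound κ r f) (hgb : CkBound κ r g)
    (hb : CkBound κ n (fun x => f x - g x)) (x : X) :
    (φ f x - φ g x) * κ x ≤ r⁻¹ * C * n := by
  rcases hn.eq_or_lt with rfl | hn
  · have : f = g := by
      funext y
      have h := hb y
      by_contra hne
      have : 0 < |f y - g y| * κ y := mul_pos (abs_pos.2 (sub_ne_zero.2 hne)) (hκpos y)
      linarith
    subst this
    simp
  set h : X → ℝ := fun y => (1 + 2 * r / n) * f y + (-(2 * r / n)) * g y with hh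
  have hm : MemCk κ h := memCk_comb hκpos hf hg _ _
  have hhb : CkBound κ (3 * r) h := by
    intro y
    have e : h y = f y + 2 * r / n * (f y - g y) := by simp only [hh]; ring
    have h1 : |h y| ≤ |f y| + 2 * r / n * |f y - g y| := by
      rw [e]
      refine (abs_add_le _ _).trans ?_
      rw [abs_mul, abs_of_pos (by positivity : 0 < 2 * r / n)]
    have h2 := mul_le_mul_of_nonneg_right h1 (hκpos y).le
    have h3 := mul_le_mul_of_nonneg_left (hb y) (by positivity : 0 ≤ 2 * r / n)
    have h4 : 2 * r / n * n = 2 * r := by field_simp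
    have h5 := hfb y
    nlinarith
  have hpos : 0 < n + 2 * r := by positivity
  have hc := hconv h g hm hg (n / (n + 2 * r)) (by positivity)
    ((div_le_one hpos).2 (by linarith)) x
  have e : (fun y => n / (n + 2 * r) * h y + (1 - n / (n + 2 * r)) * g y) = f := by
    funext y
    simp only [hh]
    field_simp
    ring
  rw [e] at hc
  have hh1 := hφ h hm hhb x
  have hg1 := hφ g hg (fun y => (hgb y).trans (by linarith)) x
  have hk := hκpos x
  have a1 : φ h x * κ x ≤ C := (mul_le_mul_of_nonneg_right (le_abs_self _) hk.le).trans hh1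
  have a2 : -φ g x * κ x ≤ C := (mul_le_mul_of_nonneg_right (neg_le_abs _) hk.le).trans hg1
  have l0 : 0 ≤ n / (n + 2 * r) := by positivity
  have l1 : n / (n + 2 * r) ≤ n / (2 * r) :=
    div_le_div_of_nonneg_left hn.le (by positivity) (by linarith)
  calc (φ f x - φ g x) * κ x ≤ (n / (n + 2 * r) * (φ h x - φ g x)) * κ x :=
        mul_le_mul_of_nonneg_right (by linarith) hk.le
    _ = n / (n + 2 * r) * (φ h x * κ x + -φ g x * κ x) := by ring
    _ ≤ n / (n + 2 * r) * (2 * C) := mul_le_mul_of_nonneg_left (by linarith) l0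
    _ ≤ n / (2 * r) * (2 * C) := mul_le_mul_of_nonneg_right l1 (by positivity)
    _ = r⁻¹ * C * n := by field_simp

/-- basic Lipschitz estimates for convex monotone operators `Φ : C_κ → F_κ`. -/
theorem stmt0
    {X : Type*} [MetricSpace X] [CompleteSpace X] [TopologicalSpace.SeparableSpace X]
    (κ : X → ℝ) (hκc : Continuous κ) (hκpos : ∀ x, 0 < κ x) (hκbd : ∃ C, ∀ x, κ x ≤ C)
    (Φ : (X → ℝ) → (X → EReal))
    (hmono : ∀ f g, MemCk κ f → MemCk κ g → (∀ x, f x ≤ g x) → ∀ x, Φ f x ≤ Φ g x)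
    (hconv : ∀ f g, MemCk κ f → MemCk κ g → ∀ lam : ℝ, 0 ≤ lam → lam ≤ 1 → ∀ x,
        Φ (fun y => lam * f y + (1 - lam) * g y) x
          ≤ (lam : EReal) * Φ f x + ((1 - lam : ℝ) : EReal) * Φ g x)
    (hzero : ∀ x, Φ (fun _ => 0) x = 0)
    (hFk : ∀ f, MemCk κ f → (∀ x, Φ f x < ⊤) ∧ eknorm κ (epos (Φ f)) ≠ ⊤)
    (r : ℝ) (hr : 0 < r) :
    ((eknorm κ (epos (Φ (fun x => r / κ x))) ≠ ⊤) ∧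
      ∀ f, MemCk κ f → CkBound κ r f →
        (∀ x, ∃ y : ℝ, Φ f x = (y : EReal)) ∧
        eknorm κ (Φ f) ≤
          (ENNReal.ofReal r)⁻¹ * eknorm κ (epos (Φ (fun x => r / κ x))) * eknorm κ (ecoe f))
    ∧
    (((⨆ f' : {g : X → ℝ // MemCk κ g ∧ CkBound κ (3 * r) g}, eknorm κ (Φ f'.1)) ≠ ⊤) ∧
      ∀ f g, MemCk κ f → MemCk κ g → CkBound κ r f → CkBound κ r g →
        eknorm κ (fun x => Φ f x - Φ g x) ≤
          (ENNReal.ofReal r)⁻¹ *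
            (⨆ f' : {g : X → ℝ // MemCk κ g ∧ CkBound κ (3 * r) g}, eknorm κ (Φ f'.1)) *
            eknorm κ (ecoe (fun x => f x - g x))) := by
  set φ : (X → ℝ) → X → ℝ := fun f x => (Φ f x).toReal with hφdef
  have hΦ : ∀ f, MemCk κ f → ∀ x, Φ f x = (φ f x : EReal) := fun f hf x =>
    phi_real hκpos Φ hconv hzero hFk f hf x
  have hmono' : ∀ f g, MemCk κ f → MemCk κ g → (∀ x, f x ≤ g x) → ∀ x, φ f x ≤ φ g x := by
    intro f g hf hg h x
    have := hmono f g hf hg h x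
    rw [hΦ f hf, hΦ g hg] at this
    exact_mod_cast this
  have hconv' : ∀ f g, MemCk κ f → MemCk κ g → ∀ lam : ℝ, 0 ≤ lam → lam ≤ 1 → ∀ x,
      φ (fun y => lam * f y + (1 - lam) * g y) x ≤ lam * φ f x + (1 - lam) * φ g x := by
    intro f g hf hg lam h0 h1 x
    have := hconv f g hf hg lam h0 h1 x
    rw [hΦ f hf, hΦ g hg, hΦ _ (memCk_comb hκpos hf hg _ _)] at this
    exact_mod_cast this
  have hzero' : ∀ x, φ (fun _ => 0) x = 0 := fun x => by simp [hφdef, hzero]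
  have part1 : ∀ r : ℝ, 0 < r → ∀ f, MemCk κ f → CkBound κ r f →
      eknorm κ (Φ f) ≤
        (ENNReal.ofReal r)⁻¹ * eknorm κ (epos (Φ (fun x => r / κ x))) * eknorm κ (ecoe f) := by
    intro r hr f hf hfb
    have hk := memCk_div hκc hκpos r
    have hep : ∀ x, epos (Φ (fun x => r / κ x)) x
        = ((max (φ (fun x => r / κ x) x) 0 : ℝ) : EReal) := by
      intro x
      simp only [epos]
      rw [hΦ _ hk]
      exact (EReal.coe_strictMono.monotone.map_max (a := φ (fun x => r / κ x) x) (b := 0)).symm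
    obtain ⟨M, hM0, hM, hMb, -⟩ := eknorm_real hep (hFk _ hk).2
    obtain ⟨n, hn0, hn, hnb, hnmin⟩ := eknorm_real (F := ecoe f) (f := f) (fun _ => rfl) (eknorm_ecoe_ne_top hf)
    rw [hM, hn, ← ENNReal.ofReal_inv_of_pos hr, ← ENNReal.ofReal_mul (by positivity),
      ← ENNReal.ofReal_mul (by positivity), eknorm_le_iff (hΦ f hf) (by positivity)]
    intro x
    have h1 := key1 hκc hκpos φ hmono' hconv' hzero' hr hn0 (hnmin r hr.le hfb) hf hnb x
    have h2 := hMb x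
    rw [abs_of_nonneg (le_max_right _ _)] at h2
    have hkx := hκpos x
    calc |φ f x| * κ x ≤ (n / r * max (φ (fun x => r / κ x) x) 0) * κ x := by
          refine mul_le_mul_of_nonneg_right (h1.trans ?_) hkx.le
          exact mul_le_mul_of_nonneg_left (le_max_left _ _) (by positivity)
      _ = n / r * (max (φ (fun x => r / κ x) x) 0 * κ x) := by ring
      _ ≤ n / r * M := mul_le_mul_of_nonneg_left h2 (by positivity)
      _ = r⁻¹ * M * n := by field_simp
  have hfin : (⨆ f' : {g : X → ℝ // MemCk κ g ∧ CkBound κ (3 * r) g}, eknorm κ (Φ f'.1)) ≠ ⊤ := by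
    have h3 : 0 < 3 * r := by positivity
    refine ne_top_of_le_ne_top (b := (ENNReal.ofReal (3 * r))⁻¹ *
      eknorm κ (epos (Φ (fun x => 3 * r / κ x))) * ENNReal.ofReal (3 * r)) ?_ (iSup_le ?_)
    · refine ENNReal.mul_ne_top (ENNReal.mul_ne_top ?_ (hFk _ (memCk_div hκc hκpos _)).2)
        ENNReal.ofReal_ne_top
      simpa using hr
    · rintro ⟨g, hg, hgb⟩
      refine (part1 _ h3 g hg hgb).trans ?_
      gcongr
      exact (eknorm_le_iff (fun _ => rfl) h3.le).2 hgb
  refine ⟨⟨(hFk _ (memCk_div hκc hκpos r)).2, fun f hf hfb =>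
    ⟨fun x => ⟨_, hΦ f hf x⟩, part1 r hr f hf hfb⟩⟩, hfin, ?_⟩
  intro f g hf hg hfb hgb
  have hsub : MemCk κ (fun x => f x - g x) := by
    have := memCk_comb hκpos hf hg 1 (-1)
    simpa [sub_eq_add_neg] using this
  obtain ⟨n, hn0, hn, hnb, -⟩ :=
    eknorm_real (F := ecoe fun x => f x - g x) (f := fun x => f x - g x) (fun _ => rfl) (eknorm_ecoe_ne_top hsub)
  set S := ⨆ f' : {g : X → ℝ // MemCk κ g ∧ CkBound κ (3 * r) g}, eknorm κ (Φ f'.1) with hS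
  have hC0 : 0 ≤ S.toReal := ENNReal.toReal_nonneg
  have hφb : ∀ f, MemCk κ f → CkBound κ (3 * r) f → CkBound κ S.toReal (φ f) := by
    intro f hf hfb
    rw [← eknorm_le_iff (hΦ f hf) hC0, ENNReal.ofReal_toReal hfin]
    exact le_iSup (fun f' : {g : X → ℝ // MemCk κ g ∧ CkBound κ (3 * r) g} => eknorm κ (Φ f'.1))
      ⟨f, hf, hfb⟩
  have hd : ∀ x, Φ f x - Φ g x = ((φ f x - φ g x : ℝ) : EReal) := by
    intro x
    rw [hΦ f hf, hΦ g hg, EReal.coe_sub]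
  rw [hn, ← ENNReal.ofReal_toReal hfin, ← ENNReal.ofReal_inv_of_pos hr,
    ← ENNReal.ofReal_mul (by positivity), ← ENNReal.ofReal_mul (by positivity),
    eknorm_le_iff hd (by positivity)]
  intro x
  have h1 := key2 hκpos φ hconv' hr hn0 hC0 hφb hf hg hfb hgb hnb x
  have hnb' : CkBound κ n (fun x => g x - f x) := fun y => by
    have := hnb y
    simp only at this ⊢
    rwa [abs_sub_comm]
  have h2 := key2 hκpos φ hconv' hr hn0 hC0 hφb hg hf hgb hfb hnb' x
  simp only
  rcases abs_cases (φ f x - φ g x) with ⟨h, _⟩ | ⟨h, _⟩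
  · rw [h]; exact h1
  · rw [h, neg_sub]; exact h2
end

section
/- For every f ∈ U_κ and ε > 0 the following hold: f^ε ≤ \bar f^ε ≤ inf_{ε' > ε} f^{ε'} pointwise; −1/ε ≤ \bar f^ε(x)·κ(x) ≤ ‖f⁺‖_κ + ε for all x ∈ X; \bar f^ε ∈ U_κ; and \bar f^ε decreases pointwise to f as ε ↓ 0. -/
open Filter MeasureTheory Topology
open scoped ENNReal Topology

open Filter Topology in
theorem par_real {X : Type*} [MetricSpace X] (κ : X → ℝ) (f : X → EReal) (N : ℝ) (hN : 0 ≤ N)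
    (hb : ∀ y, f y * (κ y : EReal) ≤ (N : EReal)) :
    ∃ m : ℝ → X → ℝ, ∀ ε, 0 < ε → ∀ x,
      (⨆ y ∈ Metric.closedBall x ε, max (f y * (κ y : EReal)) (((-ε⁻¹ : ℝ)) : EReal)) = (m ε x : EReal)
      ∧ -ε⁻¹ ≤ m ε x ∧ m ε x ≤ N ∧
      parallel κ f ε x = (((κ x)⁻¹ * (m ε x + ε) : ℝ) : EReal) := by
  refine ⟨fun ε x => (⨆ y ∈ Metric.closedBall x ε,
    max (f y * (κ y : EReal)) (((-ε⁻¹ : ℝ)) : EReal)).toReal, fun ε hε x => ?_⟩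
  have h1 : (⨆ y ∈ Metric.closedBall x ε,
      max (f y * (κ y : EReal)) (((-ε⁻¹ : ℝ)) : EReal)) ≤ (N : EReal) := by
    refine iSup₂_le fun y _ => max_le (hb y) ?_
    have : 0 < ε⁻¹ := inv_pos.mpr hε
    exact EReal.coe_le_coe_iff.mpr (by linarith)
  have h2 : ((-ε⁻¹ : ℝ) : EReal) ≤ (⨆ y ∈ Metric.closedBall x ε,
      max (f y * (κ y : EReal)) (((-ε⁻¹ : ℝ)) : EReal)) :=
    le_trans (le_max_right (f x * (κ x : EReal)) _)
      (le_iSup₂ (f := fun y (_ : y ∈ Metric.closedBall x ε) =>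
        max (f y * (κ y : EReal)) (((-ε⁻¹ : ℝ)) : EReal)) x (Metric.mem_closedBall_self hε.le))
  unfold parallel
  beta_reduce
  generalize (⨆ y ∈ Metric.closedBall x ε,
      max (f y * (κ y : EReal)) (((-ε⁻¹ : ℝ)) : EReal)) = s at h1 h2 ⊢
  have ht : s ≠ ⊤ := (lt_of_le_of_lt h1 (EReal.coe_lt_top N)).ne
  have hbt : s ≠ ⊥ := (lt_of_lt_of_le (EReal.bot_lt_coe _) h2).ne'
  lift s to ℝ using ⟨ht, hbt⟩
  simp only [EReal.toReal_coe]
  refine ⟨trivial, EReal.coe_le_coe_iff.mp h2, EReal.coe_le_coe_iff.mp h1, ?_⟩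
  push_cast
  rfl

/-- properties of the upper `ε`-parallel function and its usc envelope. -/
theorem stmt1
    {X : Type*} [MetricSpace X] [CompleteSpace X] [TopologicalSpace.SeparableSpace X]
    (κ : X → ℝ) (hκc : Continuous κ) (hκpos : ∀ x, 0 < κ x) (hκbd : ∃ C, ∀ x, κ x ≤ C)
    (f : X → EReal) (hf : MemUk κ f) (ε : ℝ) (hε : 0 < ε) :
    (∀ x, parallel κ f ε x ≤ parallelEnv κ f ε x) ∧
    (∀ x, parallelEnv κ f ε x ≤ ⨅ (ε' : ℝ) (_ : ε < ε'), parallel κ f ε' x) ∧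
    (∀ x, ((-ε⁻¹ : ℝ) : EReal) ≤ parallelEnv κ f ε x * (κ x : EReal)) ∧
    (∀ x, parallelEnv κ f ε x * (κ x : EReal) ≤ (eknorm κ (epos f) : EReal) + (ε : EReal)) ∧
    MemUk κ (parallelEnv κ f ε) ∧
    (∀ ε₁ ε₂, 0 < ε₁ → ε₁ ≤ ε₂ → ∀ x, parallelEnv κ f ε₁ x ≤ parallelEnv κ f ε₂ x) ∧
    (∀ x, (⨅ (e : ℝ) (_ : 0 < e), parallelEnv κ f e x) = f x) := by
  obtain ⟨husc, htop, r, hr⟩ := hf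
  -- the norm is finite and bounds `f κ`
  have hterm : ∀ y, ((((epos f y).abs * ENNReal.ofReal (κ y) : ℝ≥0∞)) : EReal)
      = max (f y) 0 * (κ y : EReal) := by
    intro y
    have h0 : (0 : EReal) ≤ max (f y) 0 := le_max_right _ _
    have e1 : (((epos f y).abs : ℝ≥0∞) : EReal) = max (f y) 0 := by
      change (((max (f y) 0).abs : ℝ≥0∞) : EReal) = max (f y) 0
      generalize max (f y) 0 = s at h0 ⊢
      induction s with
      | bot => exact absurd h0 (by simp)
      | top => rfl
      | coe s =>
        rw [EReal.abs_def, EReal.coe_ennreal_ofReal, abs_of_nonneg (EReal.coe_nonneg.mp h0),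
          max_eq_left (EReal.coe_nonneg.mp h0)]
    rw [EReal.coe_ennreal_mul, e1, EReal.coe_ennreal_ofReal, max_eq_left (hκpos y).le]
  have hfin : eknorm κ (epos f) ≤ ENNReal.ofReal r := by
    refine iSup_le fun y => ?_
    rw [← EReal.coe_ennreal_le_coe_ennreal_iff, hterm, EReal.coe_ennreal_ofReal]
    exact (hr y).trans (EReal.coe_le_coe_iff.mpr (le_max_left _ _))
  have hne : eknorm κ (epos f) ≠ ⊤ := ne_top_of_le_ne_top ENNReal.ofReal_ne_top hfin
  obtain ⟨N, hN0, hNe⟩ : ∃ N : ℝ, 0 ≤ N ∧ ((eknorm κ (epos f) : ℝ≥0∞) : EReal) = (N : EReal) :=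
    ⟨(eknorm κ (epos f)).toReal, ENNReal.toReal_nonneg, (EReal.coe_ennreal_toReal hne).symm⟩
  have hκE : ∀ y, (0 : EReal) ≤ (κ y : EReal) := fun y => EReal.coe_nonneg.mpr (hκpos y).le
  have hb : ∀ y, f y * (κ y : EReal) ≤ (N : EReal) := by
    intro y
    rw [← hNe]
    refine (mul_le_mul_of_nonneg_right (le_max_left (f y) 0) (hκE y)).trans ?_
    rw [← hterm, EReal.coe_ennreal_le_coe_ennreal_iff]
    exact le_iSup (fun x => (epos f x).abs * ENNReal.ofReal (κ x)) y
  obtain ⟨m, hm⟩ := par_real κ f N hN0 hb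
  -- part 1
  have P1 : ∀ e x, parallel κ f e x ≤ parallelEnv κ f e x := by
    intro e x
    refine le_iInf₂ fun δ hδ => ?_
    exact le_iSup₂ (f := fun y (_ : y ∈ Metric.closedBall x δ) => parallel κ f e y) x
      (Metric.mem_closedBall_self hδ.le)
  -- comparison of the `m`
  have mle : ∀ e e', 0 < e → e < e' → ∀ x y, dist y x ≤ e' - e → m e y ≤ m e' x := by
    intro e e' he hee x y hd
    have he' := he.trans hee
    rw [← EReal.coe_le_coe_iff, ← (hm e he y).1, ← (hm e' he' x).1]
    refine iSup₂_le fun z hz => ?_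
    have hz' : z ∈ Metric.closedBall x e' := by
      rw [Metric.mem_closedBall] at hz ⊢
      linarith [dist_triangle z y x]
    refine le_trans (max_le_max le_rfl ?_) (le_iSup₂ (f := fun y (_ : y ∈ Metric.closedBall x e') =>
        max (f y * (κ y : EReal)) (((-e'⁻¹ : ℝ)) : EReal)) z hz')
    refine EReal.coe_le_coe_iff.mpr (neg_le_neg ?_)
    exact inv_anti₀ he hee.le
  have P2 : ∀ e e', 0 < e → e < e' → ∀ x, parallelEnv κ f e x ≤ parallel κ f e' x := by
    intro e e' he hee x
    have he' := he.trans hee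
    have hcont : Tendsto (fun y => (κ y)⁻¹ * (m e' x + e)) (𝓝 x) (𝓝 ((κ x)⁻¹ * (m e' x + e))) :=
      ((hκc.tendsto x).inv₀ (hκpos x).ne').mul_const _
    have hlt : (κ x)⁻¹ * (m e' x + e) < (κ x)⁻¹ * (m e' x + e') :=
      mul_lt_mul_of_pos_left (by linarith) (inv_pos.mpr (hκpos x))
    obtain ⟨δ, hδ, hball⟩ := Metric.nhds_basis_closedBall.eventually_iff.mp
      (hcont.eventually_lt_const hlt)
    refine (iInf₂_le (min δ (e' - e)) (lt_min hδ (by linarith))).trans ?_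
    refine iSup₂_le fun y hy => ?_
    rw [Metric.mem_closedBall, le_min_iff] at hy
    rw [(hm e he y).2.2.2, (hm e' he' x).2.2.2, EReal.coe_le_coe_iff]
    have h1 := hball (Metric.mem_closedBall.mpr hy.1)
    have h2 := mle e e' he hee x y hy.2
    have h3 : (κ y)⁻¹ * (m e y + e) ≤ (κ y)⁻¹ * (m e' x + e) :=
      mul_le_mul_of_nonneg_left (by linarith) (inv_pos.mpr (hκpos y)).le
    exact h3.trans h1.le
  have pκ : ∀ e, 0 < e → ∀ x, parallel κ f e x * (κ x : EReal) = ((m e x + e : ℝ) : EReal) := by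
    intro e he x
    rw [(hm e he x).2.2.2, ← EReal.coe_mul]
    congr 1
    have := (hκpos x).ne'
    field_simp
  have P4 : ∀ x, parallelEnv κ f ε x * (κ x : EReal) ≤ ((N + ε : ℝ) : EReal) := by
    intro x
    refine EReal.le_of_forall_lt_iff_le.mp fun z hz => ?_
    have hz' : N + ε < z := EReal.coe_lt_coe_iff.mp hz
    have h1 : ε < z - N := by linarith
    refine (mul_le_mul_of_nonneg_right (P2 ε (z - N) hε h1 x) (hκE x)).trans ?_
    rw [pκ _ (hε.trans h1), EReal.coe_le_coe_iff]
    linarith [(hm _ (hε.trans h1) x).2.2.1]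
  have fle : ∀ e, 0 < e → ∀ x, f x ≤ parallel κ f e x := by
    intro e he x
    rw [(hm e he x).2.2.2]
    have h1 : f x * (κ x : EReal) ≤ (m e x : EReal) := by
      rw [← (hm e he x).1]
      exact le_trans (le_max_left (f x * (κ x : EReal)) _)
        (le_iSup₂ (f := fun y (_ : y ∈ Metric.closedBall x e) =>
        max (f y * (κ y : EReal)) (((-e⁻¹ : ℝ)) : EReal)) x (Metric.mem_closedBall_self he.le))
    have ht := htop x
    generalize f x = s at h1 ht ⊢
    induction s with
    | bot => exact bot_le
    | top => exact absurd ht (lt_irrefl _)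
    | coe s =>
      rw [← EReal.coe_mul, EReal.coe_le_coe_iff] at h1
      rw [EReal.coe_le_coe_iff, inv_mul_eq_div, le_div_iff₀ (hκpos x)]
      linarith
  have Pmono : ∀ ε₁ ε₂, 0 < ε₁ → ε₁ ≤ ε₂ → ∀ x, parallelEnv κ f ε₁ x ≤ parallelEnv κ f ε₂ x := by
    intro e₁ e₂ h1 h2 x
    rcases h2.eq_or_lt with rfl | h2
    · exact le_rfl
    · exact (P2 e₁ e₂ h1 h2 x).trans (P1 e₂ x)
  refine ⟨P1 ε, fun x => le_iInf₂ fun e' h => P2 ε e' hε h x, ?_, ?_, ⟨?_, ?_, N + ε, ?_⟩, Pmono, ?_⟩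
  · intro x
    refine le_trans ?_ (mul_le_mul_of_nonneg_right (P1 ε x) (hκE x))
    rw [pκ ε hε, EReal.coe_le_coe_iff]
    linarith [(hm ε hε x).2.1]
  · intro x
    rw [hNe, ← EReal.coe_add]
    exact P4 x
  · intro x a ha
    obtain ⟨δ, hδ⟩ := iInf_lt_iff.mp ha
    obtain ⟨hδ0, hlt⟩ := iInf_lt_iff.mp hδ
    filter_upwards [Metric.closedBall_mem_nhds x (half_pos hδ0)] with y hy
    refine lt_of_le_of_lt ((iInf₂_le (δ / 2) (half_pos hδ0)).trans ?_) hlt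
    refine iSup₂_le fun z hz => ?_
    refine le_iSup₂ (f := fun y (_ : y ∈ Metric.closedBall x δ) => parallel κ f ε y) z ?_
    rw [Metric.mem_closedBall] at hy hz ⊢
    linarith [dist_triangle z y x]
  · intro x
    refine lt_of_le_of_lt (P2 ε (ε + 1) hε (by linarith) x) ?_
    rw [(hm (ε + 1) (by linarith) x).2.2.2]
    exact EReal.coe_lt_top _
  · intro x
    rcases max_choice (parallelEnv κ f ε x) 0 with h | h <;> rw [h]
    · exact P4 x
    · rw [zero_mul]
      exact EReal.coe_nonneg.mpr (by linarith)
  · intro x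
    refine le_antisymm ?_ (le_iInf₂ fun e he => (fle e he x).trans (P1 e x))
    refine EReal.le_of_forall_lt_iff_le.mp fun a ha => ?_
    obtain ⟨c, hc1, hc2⟩ := EReal.lt_iff_exists_real_btwn.mp ha
    have hca : c < a := EReal.coe_lt_coe_iff.mp hc2
    obtain ⟨b, hb1, hb2⟩ := exists_between (mul_lt_mul_of_pos_right hca (hκpos x))
    have hev : ∀ᶠ y in 𝓝 x, f y * (κ y : EReal) ≤ (b : EReal) := by
      have hc : Tendsto (fun y => c * κ y) (𝓝 x) (𝓝 (c * κ x)) := (hκc.tendsto x).const_mul c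
      filter_upwards [husc x _ hc1, hc.eventually_lt_const hb1] with y h1 h2
      refine (mul_le_mul_of_nonneg_right h1.le (hκE y)).trans ?_
      rw [← EReal.coe_mul]
      exact EReal.coe_le_coe_iff.mpr h2.le
    obtain ⟨δ, hδ, hball⟩ := Metric.nhds_basis_closedBall.eventually_iff.mp hev
    obtain ⟨e, he0, he⟩ : ∃ e : ℝ, 0 < e ∧ e ≤ δ ∧ e ≤ a * κ x - b ∧ -e⁻¹ ≤ b := by
      have hbp : 0 < |b| + 1 := by positivity
      refine ⟨min δ (min (a * κ x - b) (|b| + 1)⁻¹),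
        lt_min hδ (lt_min (by linarith) (inv_pos.mpr hbp)), min_le_left _ _,
        (min_le_right _ _).trans (min_le_left _ _), ?_⟩
      have h1 : min δ (min (a * κ x - b) (|b| + 1)⁻¹) ≤ (|b| + 1)⁻¹ :=
        (min_le_right _ _).trans (min_le_right _ _)
      have h2 := inv_anti₀ (lt_min hδ (lt_min (by linarith) (inv_pos.mpr hbp))) h1
      rw [inv_inv] at h2
      linarith [neg_abs_le b]
    obtain ⟨he1, he2, he3⟩ := he
    refine (iInf₂_le (e / 2) (half_pos he0)).trans
      ((P2 (e / 2) e (half_pos he0) (by linarith) x).trans ?_)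
    have hmb : m e x ≤ b := by
      rw [← EReal.coe_le_coe_iff, ← (hm e he0 x).1]
      refine iSup₂_le fun y hy => max_le ?_ (EReal.coe_le_coe_iff.mpr he3)
      exact hball (Metric.closedBall_subset_closedBall he1 hy)
    rw [(hm e he0 x).2.2.2, EReal.coe_le_coe_iff, inv_mul_eq_div, div_le_iff₀ (hκpos x)]
    linarith
end

section
/- Let (f_n) ⊂ U_κ be bounded above and f ∈ U_κ. Then Γ-limsup_{n→∞} f_n ≤ f pointwise if and only if, for every ε > 0 and every compact K ⊂ X, there exists n₀ ∈ ℕ such that f_n(x) ≤ \bar f^ε(x) for all x ∈ K and all n ≥ n₀. -/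
open Filter MeasureTheory Topology
open scoped ENNReal Topology

lemma local_bound {X : Type*} [MetricSpace X] (fn : ℕ → X → EReal) (x : X) (q : EReal)
    (h : gammaLimsup fn x < q) :
    ∃ δ > (0:ℝ), ∃ N : ℕ, ∀ n ≥ N, ∀ y, dist y x < δ → fn n y ≤ q := by
  by_contra! hc
  have hP : ∀ k : ℕ, ∃ᶠ n in atTop, ∃ y, dist y x < 1 / ((k:ℝ) + 1) ∧ q < fn n y := by
    intro k
    rw [Filter.frequently_atTop]
    intro N
    obtain ⟨n, hn, y, hy, hq⟩ := hc (1 / ((k:ℝ) + 1)) (by positivity) N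
    exact ⟨n, hn, y, hy, hq⟩
  obtain ⟨φ, hφ, hy⟩ := Filter.extraction_forall_of_frequently hP
  choose y hyd hyq using hy
  set u : ℕ → X := Function.extend φ y (fun _ => x) with hu
  have hut : Tendsto u atTop (𝓝 x) := by
    rw [Metric.tendsto_atTop]
    intro e he
    obtain ⟨k, hk⟩ := exists_nat_one_div_lt he
    refine ⟨φ k, fun n hn => ?_⟩
    by_cases hr : ∃ j, φ j = n
    · obtain ⟨j, rfl⟩ := hr
      have hkj : k ≤ j := hφ.le_iff_le.1 hn
      rw [hu, hφ.injective.extend_apply]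
      refine lt_trans (hyd j) (lt_of_le_of_lt ?_ hk)
      have : (k:ℝ) ≤ j := by exact_mod_cast hkj
      gcongr
    · rw [hu, Function.extend_apply' _ _ _ hr]
      simpa using he
  have h1 : q ≤ Filter.limsup (fun n => fn n (u n)) atTop := by
    apply Filter.le_limsup_of_frequently_le
    · rw [Filter.frequently_atTop]
      intro N
      refine ⟨φ N, hφ.id_le N, ?_⟩
      rw [hu, hφ.injective.extend_apply]
      exact (hyq N).le
    · exact Filter.isBounded_le_of_top
  have h2 : Filter.limsup (fun n => fn n (u n)) atTop ≤ gammaLimsup fn x :=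
    le_iSup₂_of_le (f := fun (u : ℕ → X) (_ : Tendsto u atTop (𝓝 x)) =>
      Filter.limsup (fun n => fn n (u n)) atTop) u hut le_rfl
  exact absurd (h1.trans h2) (not_le.2 h)

lemma parallel_le_env {X : Type*} [MetricSpace X] (κ : X → ℝ) (f : X → EReal) (ε : ℝ) (x : X) :
    parallel κ f ε x ≤ parallelEnv κ f ε x := by
  refine le_iInf₂ fun δ hδ => ?_
  exact le_iSup₂_of_le (f := fun y (_ : y ∈ Metric.closedBall x δ) => parallel κ f ε y) x
    (Metric.mem_closedBall_self hδ.le) le_rfl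

lemma aux_q (a : EReal) (ha : a < ⊤) (k ε : ℝ) (hk : 0 < k) (hε : 0 < ε) :
    ∃ c q : ℝ, (c : EReal) ≤ max (a * (k : EReal)) ((-ε⁻¹ : ℝ) : EReal) ∧ a < (q : EReal) ∧
      q * k < c + ε := by
  induction a with
  | bot =>
    refine ⟨-ε⁻¹, (-ε⁻¹ + ε / 2) / k, le_max_right _ _, EReal.bot_lt_coe _, ?_⟩
    rw [div_mul_cancel₀ _ hk.ne']; linarith
  | top => exact absurd ha (lt_irrefl _)
  | coe a =>
    refine ⟨a * k, (a * k + ε / 2) / k, ?_, ?_, ?_⟩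
    · rw [EReal.coe_mul]; exact le_max_left _ _
    · rw [EReal.coe_lt_coe_iff, lt_div_iff₀ hk]; linarith
    · rw [div_mul_cancel₀ _ hk.ne']; linarith

lemma env_le {X : Type*} [MetricSpace X] (κ : X → ℝ) (hκc : Continuous κ)
    (hκpos : ∀ x, 0 < κ x) (f : X → EReal) (hf : UpperSemicontinuous f) (x : X) (q' q : ℝ)
    (h1 : f x < (q' : EReal)) (h2 : q' < q) :
    ∃ ε > (0:ℝ), ∀ᶠ w in 𝓝 x, parallelEnv κ f ε w ≤ (q : EReal) := by
  have hk := hκpos x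
  obtain ⟨c, hc1, hc2⟩ := exists_between (mul_lt_mul_of_pos_right h2 hk)
  obtain ⟨d, hd1, hd2⟩ := exists_between hc2
  have e1 : ∀ᶠ y in 𝓝 x, f y < (q' : EReal) := hf x _ h1
  have e2 : ∀ᶠ y in 𝓝 x, q' * κ y < c :=
    ((continuous_const.mul hκc).tendsto x).eventually (gt_mem_nhds hc1)
  have e3 : ∀ᶠ y in 𝓝 x, d < q * κ y :=
    ((continuous_const.mul hκc).tendsto x).eventually (lt_mem_nhds hd2)
  obtain ⟨r, hr, hb⟩ := Metric.eventually_nhds_iff.1 (e1.and (e2.and e3))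
  set ε : ℝ := min (min (r / 4) (d - c)) (1 / (|c| + 1)) with hε
  have hε0 : 0 < ε := by
    rw [hε]; refine lt_min (lt_min (by linarith) (by linarith)) (by positivity)
  have hεr : ε ≤ r / 4 := (min_le_left _ _).trans (min_le_left _ _)
  have hεd : ε ≤ d - c := (min_le_left _ _).trans (min_le_right _ _)
  have hεc : -ε⁻¹ ≤ c := by
    have : ε ≤ 1 / (|c| + 1) := min_le_right _ _
    have h3 : |c| + 1 ≤ ε⁻¹ := by
      rw [le_inv_comm₀ (by positivity) hε0]; simpa using this
    have := neg_abs_le c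
    linarith
  refine ⟨ε, hε0, ?_⟩
  filter_upwards [Metric.ball_mem_nhds x (show 0 < r / 4 by linarith)] with w hw
  rw [Metric.mem_ball] at hw
  refine iInf₂_le_of_le (r / 4) (by linarith) (iSup₂_le fun z hz => ?_)
  rw [Metric.mem_closedBall] at hz
  have hzx : dist z x < r / 2 := by linarith [dist_triangle z w x]
  have hS : (⨆ y ∈ Metric.closedBall z ε, max (f y * (κ y : EReal)) (((-ε⁻¹ : ℝ)) : EReal))
      ≤ (c : EReal) := by
    refine iSup₂_le fun y hy => ?_
    rw [Metric.mem_closedBall] at hy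
    obtain ⟨g1, g2, g3⟩ := hb (show dist y x < r by linarith [dist_triangle y z x])
    refine max_le ?_ (EReal.coe_le_coe_iff.2 hεc)
    calc f y * (κ y : EReal) ≤ (q' : EReal) * (κ y : EReal) :=
          mul_le_mul_of_nonneg_right g1.le (EReal.coe_nonneg.2 (hκpos y).le)
      _ = ((q' * κ y : ℝ) : EReal) := (EReal.coe_mul _ _).symm
      _ ≤ c := EReal.coe_le_coe_iff.2 g2.le
  obtain ⟨g1, g2, g3⟩ := hb (show dist z x < r by linarith)
  unfold parallel
  calc _ ≤ (((κ z)⁻¹ : ℝ) : EReal) * ((c : EReal) + (ε : EReal)) :=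
        mul_le_mul_of_nonneg_left (add_le_add_left hS _)
          (EReal.coe_nonneg.2 (inv_pos.2 (hκpos z)).le)
    _ = (((κ z)⁻¹ * (c + ε) : ℝ) : EReal) := by rw [← EReal.coe_add, ← EReal.coe_mul]
    _ ≤ q := by
      rw [EReal.coe_le_coe_iff, inv_mul_le_iff₀ (hκpos z)]
      linarith

/-- characterization of `Γ-limsup f_n ≤ f` via the parallel envelopes. -/
theorem stmt2
    {X : Type*} [MetricSpace X] [CompleteSpace X] [TopologicalSpace.SeparableSpace X]
    (κ : X → ℝ) (hκc : Continuous κ) (hκpos : ∀ x, 0 < κ x) (hκbd : ∃ C, ∀ x, κ x ≤ C)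
    (f : X → EReal) (hf : MemUk κ f)
    (fn : ℕ → X → EReal) (hfn : ∀ n, MemUk κ (fn n))
    (hbd : ∃ r : ℝ, ∀ n x, max (fn n x) 0 * (κ x : EReal) ≤ (r : EReal)) :
    (∀ x, gammaLimsup fn x ≤ f x) ↔
      ∀ ε > (0:ℝ), ∀ K : Set X, IsCompact K →
        ∃ n₀ : ℕ, ∀ x ∈ K, ∀ n ≥ n₀, fn n x ≤ parallelEnv κ f ε x := by
  constructor
  · intro hG ε hε K hK
    refine hK.induction_on (p := fun K => ∃ n₀ : ℕ, ∀ x ∈ K, ∀ n ≥ n₀,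
      fn n x ≤ parallelEnv κ f ε x) ?_ ?_ ?_ ?_
    · exact ⟨0, fun x hx => absurd hx (Set.notMem_empty x)⟩
    · rintro s t hst ⟨N, hN⟩
      exact ⟨N, fun x hx => hN x (hst hx)⟩
    · rintro s t ⟨N, hN⟩ ⟨M, hM⟩
      refine ⟨max N M, fun x hx n hn => ?_⟩
      rcases hx with hx | hx
      · exact hN x hx n ((le_max_left _ _).trans hn)
      · exact hM x hx n ((le_max_right _ _).trans hn)
    · intro x hx
      obtain ⟨c, q, hc, hq, hqc⟩ := aux_q (f x) (hf.2.1 x) (κ x) ε (hκpos x) hε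
      obtain ⟨δ, hδ, N, hN⟩ := local_bound fn x q ((hG x).trans_lt hq)
      have e2 : ∀ᶠ y in 𝓝 x, q * κ y < c + ε :=
        ((continuous_const.mul hκc).tendsto x).eventually (gt_mem_nhds hqc)
      refine ⟨_, mem_nhdsWithin_of_mem_nhds (Filter.inter_mem e2
        (Filter.inter_mem (Metric.ball_mem_nhds x hδ) (Metric.ball_mem_nhds x hε))), N, ?_⟩
      rintro y ⟨hy1, hy2, hy3⟩ n hn
      refine (hN n hn y hy2).trans (le_trans ?_ (parallel_le_env κ f ε y))
      have hS : (c : EReal) ≤ ⨆ z ∈ Metric.closedBall y ε,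
          max (f z * (κ z : EReal)) (((-ε⁻¹ : ℝ)) : EReal) := by
        refine hc.trans (le_iSup₂_of_le (f := fun z (_ : z ∈ Metric.closedBall y ε) =>
          max (f z * (κ z : EReal)) (((-ε⁻¹ : ℝ)) : EReal)) x ?_ le_rfl)
        rw [Metric.mem_closedBall, dist_comm]
        exact (Metric.mem_ball.1 hy3).le
      unfold parallel
      calc (q : EReal) ≤ (((κ y)⁻¹ * (c + ε) : ℝ) : EReal) := by
            rw [EReal.coe_le_coe_iff, le_inv_mul_iff₀ (hκpos y), mul_comm]
            exact le_of_lt hy1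
        _ = (((κ y)⁻¹ : ℝ) : EReal) * ((c : EReal) + (ε : EReal)) := by
            rw [← EReal.coe_add, ← EReal.coe_mul]
        _ ≤ _ := mul_le_mul_of_nonneg_left (add_le_add_left hS _)
            (EReal.coe_nonneg.2 (inv_pos.2 (hκpos y)).le)
  · intro H x
    refine iSup₂_le fun u hu => ?_
    refine le_of_forall_gt_imp_ge_of_dense fun b hb => ?_
    obtain ⟨q, hq1, hq2⟩ := EReal.lt_iff_exists_real_btwn.1 hb
    obtain ⟨q', hq1', hq2'⟩ := EReal.lt_iff_exists_real_btwn.1 hq1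
    obtain ⟨ε, hε, hev⟩ := env_le κ hκc hκpos f hf.1 x q' q hq1' (EReal.coe_lt_coe_iff.1 hq2')
    obtain ⟨N, hN⟩ := H ε hε _ hu.isCompact_insert_range
    refine le_trans (Filter.limsup_le_of_le Filter.isCobounded_le_of_bot ?_) hq2.le
    filter_upwards [hu.eventually hev, eventually_ge_atTop N] with n h1 h2
    exact (hN (u n) (Set.mem_insert_of_mem _ (Set.mem_range_self n)) n h2).trans h1
end
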